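/- Let F be a compact topological n-manifold with boundary, and let ∂F denote its boundary. Let ∼ be the equivalence relation on F × [0,1] generated by (x,t) ∼ (x, 1−t) for every x ∈ ∂F and every t ∈ [0,1]. Then the quotient space (F × [0,1])/∼ is homeomorphic to F × [0,1]. -/

import Mathlib

open unitInterval

/-- The boundary of a topological manifold with boundary, modeled on the half-space
`EuclideanHalfSpace n = {x : ℝⁿ // 0 ≤ x 0}`: the set of points sent by some chart
into the hyperplane `{x | x 0 = 0}`. -/
def manifoldBoundary (n : ℕ) [NeZero n] (F : Type*) [TopologicalSpace F]
    [ChartedSpace (EuclideanHalfSpace n) F] : Set F :=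
  {x | ∃ e ∈ atlas (EuclideanHalfSpace n) F, x ∈ e.source ∧ (e x).val 0 = 0}

section

open Set Filter Topology MeasureTheory Metric

section Brouwer

variable {E : Type*} [NormedAddCommGroup E] [InnerProductSpace ℝ E] [FiniteDimensional ℝ E]

theorem exists_polynomial_eval_eq_det_one_add_smul (A : E →L[ℝ] E) :
    ∃ p : Polynomial ℝ, p.natDegree ≤ Module.finrank ℝ E ∧
      ∀ t : ℝ, p.eval t = (1 + t • A).det := by
  let b := Module.finBasis ℝ E
  let M := LinearMap.toMatrix b b (A : E →ₗ[ℝ] E)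
  refine ⟨Matrix.det ((Polynomial.X : Polynomial ℝ) • M.map Polynomial.C +
    (1 : Matrix _ _ ℝ).map Polynomial.C), ?_, fun t => ?_⟩
  · simpa using Polynomial.natDegree_det_X_add_C_le M 1
  · rw [ContinuousLinearMap.det, ← LinearMap.det_toMatrix b, ← Polynomial.coe_evalRingHom,
      RingHom.map_det]
    congr 1
    have h1 : LinearMap.toMatrix b b ((1 + t • A : E →L[ℝ] E) : E →ₗ[ℝ] E) = 1 + t • M := by
      have : ((1 + t • A : E →L[ℝ] E) : E →ₗ[ℝ] E) = 1 + t • (A : E →ₗ[ℝ] E) := rfl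
      rw [this, map_add, map_smul, LinearMap.toMatrix_one]
    rw [h1]
    ext i j
    by_cases hij : i = j <;> simp [hij] <;> ring

variable [MeasurableSpace E] [BorelSpace E]

theorem setIntegral_det_one_add_smul_eq_of_eventually {A : E → E →L[ℝ] E} (hA : Continuous A)
    {r c : ℝ}
    (h : ∀ᶠ t : ℝ in 𝓝 0, ∫ x in ball (0 : E) r, (1 + t • A x).det = c) (t : ℝ) :
    ∫ x in ball (0 : E) r, (1 + t • A x).det = c := by
  obtain ⟨ε, hε, h⟩ := Metric.eventually_nhds_iff.1 h
  set n := Module.finrank ℝ E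
  let s := Finset.range (n + 1)
  let v : ℕ → ℝ := fun i => ε * ((i : ℝ) / (n + 1))
  have hinj : Set.InjOn v s := by
    intro i _ j _ hij
    have h1 : (i : ℝ) / (n + 1) = j / (n + 1) := mul_left_cancel₀ hε.ne' hij
    have h2 : (n + 1 : ℝ) ≠ 0 := by positivity
    field_simp at h1
    exact_mod_cast h1
  have hv : ∀ i ∈ s, ∫ x in ball (0 : E) r, (1 + v i • A x).det = c := by
    intro i hi
    apply h
    have hi' : (i : ℝ) < n + 1 := by exact_mod_cast Finset.mem_range.1 hi
    have h2 : (i : ℝ) / (n + 1) < 1 := by rw [div_lt_one (by positivity)]; exact hi'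
    have h3 : 0 ≤ (i : ℝ) / (n + 1) := by positivity
    rw [Real.dist_eq, sub_zero, abs_of_nonneg (by positivity)]
    nlinarith
  have key : ∀ x, (1 + t • A x).det =
      ∑ i ∈ s, (1 + v i • A x).det * (Lagrange.basis s v i).eval t := by
    intro x
    obtain ⟨p, hp, hpe⟩ := exists_polynomial_eval_eq_det_one_add_smul (A x)
    have hdeg : p.degree < s.card := by
      rw [Finset.card_range]
      exact lt_of_le_of_lt Polynomial.degree_le_natDegree (by exact_mod_cast Nat.lt_succ_of_le hp)
    have := congrArg (Polynomial.eval t) (Lagrange.eq_interpolate hinj hdeg)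
    rw [hpe, Lagrange.interpolate_apply, Polynomial.eval_finsetSum] at this
    rw [this]
    refine Finset.sum_congr rfl fun i _ => ?_
    rw [Polynomial.eval_mul, Polynomial.eval_C, hpe]
  have hint_det : ∀ u : ℝ, IntegrableOn (fun x => (1 + u • A x).det) (ball (0 : E) r) := by
    intro u
    have : Continuous fun x => (1 + u • A x).det :=
      ContinuousLinearMap.continuous_det.comp (by fun_prop)
    exact (this.continuousOn.integrableOn_compact (isCompact_closedBall (0 : E) r)).mono_set
      ball_subset_closedBall
  simp_rw [key]
  rw [integral_finsetSum _ fun i _ => (hint_det (v i)).mul_const _]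
  simp_rw [integral_mul_const]
  rw [Finset.sum_congr rfl fun i hi => by rw [hv i hi], ← Finset.mul_sum,
    ← Polynomial.eval_finsetSum, Lagrange.sum_basis hinj ⟨0, by simp [s]⟩, Polynomial.eval_one,
    mul_one]

/-- A `C¹` perturbation of the identity vanishing on a sphere preserves the signed volume of the
ball. -/
theorem setIntegral_det_one_add_fderiv {η : E → E} (hη : ContDiff ℝ 1 η) {r : ℝ}
    (h0 : ∀ x ∈ sphere (0 : E) r, η x = 0) :
    ∫ x in ball (0 : E) r, (1 + fderiv ℝ η x).det = volume.real (ball (0 : E) r) := by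
  have hη' : Continuous (fderiv ℝ η) := hη.continuous_fderiv one_ne_zero
  obtain ⟨K, hK⟩ : ∃ K : NNReal, LipschitzOnWith K η (closedBall (0 : E) r) := by
    obtain ⟨C, hC⟩ := (isCompact_closedBall (0 : E) r).exists_bound_of_continuousOn
      hη'.continuousOn
    refine ⟨C.toNNReal, (convex_closedBall _ _).lipschitzOnWith_of_nnnorm_fderiv_le
      (fun x _ => (hη.differentiable one_ne_zero) x) fun x hx => ?_⟩
    rw [← NNReal.coe_le_coe, coe_nnnorm]
    exact (hC x hx).trans (Real.le_coe_toNNReal C)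
  let ζ : E → E := (closedBall (0 : E) r).indicator η
  have hζ_in : ∀ x ∈ closedBall (0 : E) r, ζ x = η x := fun x hx => indicator_of_mem hx _
  have hζ_out : ∀ x ∉ closedBall (0 : E) r, ζ x = 0 := fun x hx => indicator_of_notMem hx _
  have hmix : ∀ x ∈ closedBall (0 : E) r, ∀ y ∉ closedBall (0 : E) r,
      dist (ζ x) (ζ y) ≤ K * dist x y := by
    intro x hx y hy
    obtain ⟨z, hz, hzr⟩ : ∃ z ∈ segment ℝ x y, ‖z‖ = r := by
      have := (convex_segment (𝕜 := ℝ) x y).isPreconnected.intermediate_value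
        (left_mem_segment ℝ x y) (right_mem_segment ℝ x y)
        (continuous_norm (E := E)).continuousOn
      simp only [mem_closedBall_zero_iff, not_le] at hx hy
      exact this ⟨hx, hy.le⟩
    have hzs : z ∈ sphere (0 : E) r := by simpa using hzr
    rw [hζ_in x hx, hζ_out y hy, ← h0 z hzs]
    refine (hK.dist_le_mul x hx z (sphere_subset_closedBall hzs)).trans ?_
    have := dist_add_dist_of_mem_segment hz
    have := dist_nonneg (x := z) (y := y)
    gcongr
    linarith
  have hζ : LipschitzWith K ζ := by
    refine LipschitzWith.of_dist_le_mul fun x y => ?_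
    by_cases hx : x ∈ closedBall (0 : E) r <;> by_cases hy : y ∈ closedBall (0 : E) r
    · rw [hζ_in x hx, hζ_in y hy]; exact hK.dist_le_mul x hx y hy
    · exact hmix x hx y hy
    · rw [dist_comm, dist_comm x]; exact hmix y hy x hx
    · rw [hζ_out x hx, hζ_out y hy, dist_self]; positivity
  have hev : ∀ᶠ t : ℝ in 𝓝 0, ∫ x in ball (0 : E) r, (1 + t • fderiv ℝ η x).det =
      volume.real (ball (0 : E) r) := by
    have hsmall : ∀ᶠ t : ℝ in 𝓝 0, |t| * K < 1 := by
      have : Tendsto (fun t : ℝ => |t| * K) (𝓝 0) (𝓝 (|0| * K)) :=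
        Continuous.tendsto (by fun_prop) 0
      exact this.eventually_lt_const (by simp)
    have hpos : ∀ᶠ t : ℝ in 𝓝 0, ∀ x ∈ closedBall (0 : E) r, 0 < (1 + t • fderiv ℝ η x).det := by
      refine (isCompact_closedBall _ _).eventually_forall_of_forall_eventually fun x _ => ?_
      have : Continuous fun z : ℝ × E => (1 + z.1 • fderiv ℝ η z.2).det :=
        ContinuousLinearMap.continuous_det.comp (by fun_prop)
      refine (this.tendsto (0, x)).eventually_const_lt ?_
      simp [ContinuousLinearMap.det]
    filter_upwards [hsmall, hpos] with t ht hdet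
    let h : E → E := fun x => x + t • ζ x
    have hbij : Function.Bijective h := by
      have happ : ApproximatesLinearOn h ((ContinuousLinearEquiv.refl ℝ E : E ≃L[ℝ] E) : E →L[ℝ] E)
          univ (‖t‖₊ * K) := by
        rw [ApproximatesLinearOn.approximatesLinearOn_iff_lipschitzOnWith, lipschitzOnWith_univ]
        have : h - ((ContinuousLinearEquiv.refl ℝ E : E ≃L[ℝ] E) : E →L[ℝ] E) =
            fun x => t • ζ x := by
          ext x; simp [h]
        rw [this]
        exact (lipschitzWith_smul t).comp hζ
      have hc : Subsingleton E ∨ ‖t‖₊ * K <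
          ‖((ContinuousLinearEquiv.refl ℝ E).symm : E →L[ℝ] E)‖₊⁻¹ := by
        rcases subsingleton_or_nontrivial E with hE | hE
        · exact Or.inl hE
        · right
          have : ‖((ContinuousLinearEquiv.refl ℝ E).symm : E →L[ℝ] E)‖₊ = 1 := by
            rw [← NNReal.coe_inj, coe_nnnorm]
            exact ContinuousLinearMap.norm_id
          rw [this, inv_one, ← NNReal.coe_lt_coe]
          simpa using ht
      exact (happ.toHomeomorph h hc).bijective
    have himage : h '' ball (0 : E) r = ball (0 : E) r := by
      have hfix : ∀ x ∉ ball (0 : E) r, h x = x := by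
        intro x hx
        have : ζ x = 0 := by
          by_cases hx' : x ∈ closedBall (0 : E) r
          · rw [hζ_in x hx']
            apply h0
            simp only [mem_ball_zero_iff, not_lt, mem_closedBall_zero_iff] at hx hx'
            simpa using le_antisymm hx' hx
          · exact hζ_out x hx'
        simp [h, this]
      have hc : h '' (ball (0 : E) r)ᶜ = (ball (0 : E) r)ᶜ := by
        exact (image_congr (g := id) hfix).trans (image_id _)
      rw [← compl_inj_iff, ← image_compl_eq hbij, hc]
    have hderiv : ∀ x ∈ ball (0 : E) r,
        HasFDerivWithinAt h (1 + t • fderiv ℝ η x) (ball (0 : E) r) x := by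
      intro x hx
      have h1 : HasFDerivAt (fun x => x + t • η x) (1 + t • fderiv ℝ η x) x :=
        (hasFDerivAt_id x).add (((hη.differentiable one_ne_zero) x).hasFDerivAt.const_smul t)
      refine h1.hasFDerivWithinAt.congr (fun y hy => ?_) ?_
      · simp only [h, hζ_in y (ball_subset_closedBall hy)]
      · simp only [h, hζ_in x (ball_subset_closedBall hx)]
    have := integral_image_eq_integral_abs_det_fderiv_smul volume measurableSet_ball hderiv
      hbij.injective.injOn (fun _ => (1 : ℝ))
    rw [himage] at this
    simp only [smul_eq_mul, mul_one, integral_const, measureReal_restrict_apply_univ] at this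
    rw [this]
    refine setIntegral_congr_fun measurableSet_ball fun x hx => ?_
    exact (abs_of_pos (hdet x (ball_subset_closedBall hx))).symm
  simpa using setIntegral_det_one_add_smul_eq_of_eventually hη' hev 1

/-- The `C¹` no-retraction theorem. -/
theorem exists_eq_zero_of_contDiff [Nontrivial E] {f : E → E} (hf : ContDiff ℝ 1 f) {r : ℝ}
    (hr : 0 < r) (h : ∀ x ∈ sphere (0 : E) r, f x = x) : ∃ x, f x = 0 := by
  by_contra! hne
  let ρ : E → E := fun x => (r / ‖f x‖) • f x
  have hρ : ContDiff ℝ 1 ρ :=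
    (contDiff_const.div (hf.norm ℝ hne) fun x => norm_ne_zero_iff.2 (hne x)).smul hf
  have hnorm : ∀ x, ‖ρ x‖ = r := by
    intro x
    have := norm_ne_zero_iff.2 (hne x)
    simp only [ρ, norm_smul, norm_div, norm_norm, Real.norm_of_nonneg hr.le]
    field_simp
  have hdet : ∀ x, (fderiv ℝ ρ x).det = 0 := by
    intro x
    by_contra hd
    have hd' : LinearMap.det (fderiv ℝ ρ x : E →ₗ[ℝ] E) ≠ 0 := hd
    obtain ⟨v, hv⟩ := (LinearMap.equivOfDetNeZero _ hd').surjective (ρ x)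
    have hv' : fderiv ℝ ρ x v = ρ x := hv
    have h1 : HasFDerivAt (fun y => inner ℝ (ρ y) (ρ y)) _ x :=
      ((hρ.differentiable one_ne_zero) x).hasFDerivAt.inner ℝ
        ((hρ.differentiable one_ne_zero) x).hasFDerivAt
    have h2 : (fun y => inner ℝ (ρ y) (ρ y)) = fun _ => r ^ 2 := by
      ext y; rw [real_inner_self_eq_norm_sq, hnorm]
    rw [h2] at h1
    have h3 := congrArg (fun L : E →L[ℝ] ℝ => L v) (h1.unique (hasFDerivAt_const _ x))
    simp [hv', hnorm] at h3
    exact hr.ne' h3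
  have hη : ContDiff ℝ 1 fun x => ρ x - x := hρ.sub contDiff_id
  have := setIntegral_det_one_add_fderiv hη (fun x hx => by
    have hx' : ‖x‖ = r := by simpa using hx
    simp only [ρ, h x hx, hx', div_self hr.ne', one_smul, sub_self])
  have hfd : ∀ x, 1 + fderiv ℝ (fun x => ρ x - x) x = fderiv ℝ ρ x := by
    intro x
    rw [fderiv_fun_sub ((hρ.differentiable one_ne_zero) x) differentiableAt_fun_id, fderiv_fun_id]
    exact add_sub_cancel _ _
  simp only [hfd, hdet, integral_zero] at this
  have hpos : 0 < volume.real (ball (0 : E) r) := by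
    rw [measureReal_def]
    exact ENNReal.toReal_pos (measure_ball_pos volume _ hr).ne' measure_ball_lt_top.ne
  exact hpos.ne this

end Brouwer

/-- A continuous map moving every point of a closed ball by less than the radius attains the
centre of the ball. -/
theorem exists_eq_of_dist_lt {E : Type*} [NormedAddCommGroup E] [InnerProductSpace ℝ E]
    [FiniteDimensional ℝ E] [Nontrivial E] {f : E → E} {u : E} {r : ℝ} (hr : 0 < r)
    (hf : ContinuousOn f (closedBall u r)) (h : ∀ x ∈ closedBall u r, dist (f x) x < r) :
    ∃ x ∈ closedBall u r, f x = u := by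
  borelize E
  let P : E → E := fun x => (r / max r ‖x‖) • x
  have hmax : ∀ x : E, 0 < max r ‖x‖ := fun x => lt_max_of_lt_left hr
  have hP : Continuous P :=
    (continuous_const.div (by fun_prop) fun x => (hmax x).ne').smul continuous_id
  have hPmem : ∀ x, u + P x ∈ closedBall u r := by
    intro x
    rw [mem_closedBall, dist_self_add_left, norm_smul, Real.norm_of_nonneg (by positivity),
      div_mul_eq_mul_div, div_le_iff₀ (hmax x)]
    gcongr
    exact le_max_right _ _
  have hPid : ∀ x, ‖x‖ ≤ r → P x = x := by
    intro x hx
    simp only [P, max_eq_left hx, div_self hr.ne', one_smul]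
  let φ : E → E := fun x => f (u + P x) - u
  have hφ : Continuous φ :=
    (hf.comp_continuous (continuous_const.add hP) hPmem).sub continuous_const
  let k : E → E := fun x => (max 0 (min 1 (2 - ‖x‖ / r))) • (φ x - P x)
  have hk : Continuous k :=
    Continuous.smul (by fun_prop) (hφ.sub hP)
  have hlt : ∀ x, ‖φ x - P x‖ < r := by
    intro x
    have := h _ (hPmem x)
    rwa [dist_eq_norm, ← sub_sub] at this
  by_contra! hne
  obtain ⟨g, hg, hgk, hsupp⟩ := hk.exists_contDiff_approx 1
    (ε := fun x => min ‖φ x‖ (r - ‖φ x - P x‖)) (by fun_prop) (fun x =>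
      lt_min (norm_pos_iff.2 (sub_ne_zero.2 (hne _ (hPmem x)))) (sub_pos.2 (hlt x)))
  obtain ⟨x, hx⟩ := exists_eq_zero_of_contDiff (f := fun x => x + g x) (r := 2 * r)
    (contDiff_id.add hg) (by positivity) (fun x hx => by
      have hx' : ‖x‖ = 2 * r := by simpa using hx
      have hk0 : k x = 0 := by
        have : ‖x‖ / r = 2 := by rw [hx']; field_simp
        simp [k, this]
      have : g x = 0 := by
        by_contra hgx
        exact hsupp hgx hk0
      simp [this])
  have hgx : g x = -x := (neg_eq_of_add_eq_zero_right hx).symm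
  have hd := lt_min_iff.1 (hgk x)
  rw [dist_eq_norm, hgx] at hd
  rcases le_total ‖x‖ r with hxr | hxr
  · have hkx : k x = φ x - x := by
      have : ‖x‖ / r ≤ 1 := (div_le_one hr).2 hxr
      simp only [k, hPid x hxr]
      rw [min_eq_left (by linarith), max_eq_right zero_le_one, one_smul]
    rw [hkx, show -x - (φ x - x) = -φ x by abel, norm_neg] at hd
    exact lt_irrefl _ hd.1
  · have hkx : ‖k x‖ ≤ ‖φ x - P x‖ := by
      simp only [k]
      rw [norm_smul, Real.norm_of_nonneg (le_max_left _ _)]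
      exact mul_le_of_le_one_left (norm_nonneg _) (max_le zero_le_one (min_le_left _ _))
    have h1 := norm_sub_norm_le (-x) (k x)
    rw [norm_neg] at h1
    linarith [hd.2]

namespace EuclideanHalfSpace

variable {n : ℕ} [NeZero n]

/-- Replace the first coordinate of `y` by the nonnegative part of `r`. -/
noncomputable def withHeight (y : EuclideanSpace ℝ (Fin n)) (r : ℝ) : EuclideanHalfSpace n :=
  ⟨WithLp.toLp 2 (Function.update y 0 (max r 0)), by simp⟩

@[simp]
theorem withHeight_val_zero (y : EuclideanSpace ℝ (Fin n)) (r : ℝ) :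
    (withHeight y r).val 0 = max r 0 := by
  simp [withHeight]

@[simp]
theorem withHeight_withHeight (y : EuclideanSpace ℝ (Fin n)) (r s : ℝ) :
    withHeight (withHeight y r).val s = withHeight y s := by
  ext i
  by_cases hi : i = 0 <;> simp [withHeight, Function.update, hi]

theorem withHeight_eq_self (y : EuclideanHalfSpace n) {r : ℝ} (h : max r 0 = y.val 0) :
    withHeight y.val r = y := by
  ext i
  by_cases hi : i = 0
  · subst hi; simp [h]
  · simp [withHeight, Function.update, hi]

theorem continuous_val : Continuous (Subtype.val : EuclideanHalfSpace n → _) :=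
  continuous_subtype_val

theorem continuous_withHeight :
    Continuous fun p : EuclideanSpace ℝ (Fin n) × ℝ => withHeight p.1 p.2 := by
  refine Continuous.subtype_mk (Continuous.comp (PiLp.continuous_toLp 2 _) ?_) _
  exact ((PiLp.continuous_ofLp 2 _).comp continuous_fst).update 0 (by fun_prop)

theorem dist_withHeight_withHeight (y : EuclideanSpace ℝ (Fin n)) (r s : ℝ) :
    dist (withHeight y r).val (withHeight y s).val = |max r 0 - max s 0| := by
  have : (withHeight y r).val - (withHeight y s).val =
      EuclideanSpace.single 0 (max r 0 - max s 0) := by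
    ext i
    by_cases hi : i = 0 <;> simp [withHeight, hi]
  rw [dist_eq_norm, this, PiLp.norm_single, Real.norm_eq_abs]

/-- Invariance of the boundary under local homeomorphisms of the half-space. -/
theorem val_zero_eq_zero_of_openPartialHomeomorph
    (φ : OpenPartialHomeomorph (EuclideanHalfSpace n) (EuclideanHalfSpace n))
    {z : EuclideanHalfSpace n} (hz : z ∈ φ.source) (h : (φ z).val 0 = 0) : z.val 0 = 0 := by
  by_contra hne
  have hpos : 0 < z.val 0 := lt_of_le_of_ne z.2 (Ne.symm hne)
  let π : EuclideanSpace ℝ (Fin n) → EuclideanHalfSpace n := fun x => withHeight x (x 0)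
  have hπ : Continuous π :=
    continuous_withHeight.comp (f := fun x : EuclideanSpace ℝ (Fin n) => (x, x 0))
      (continuous_id.prodMk (EuclideanSpace.proj (𝕜 := ℝ) (0 : Fin n)).continuous)
  have hπval : ∀ x : EuclideanSpace ℝ (Fin n), 0 ≤ x 0 → (π x).val = x := fun x hx =>
    congrArg Subtype.val (withHeight_eq_self ⟨x, hx⟩ (max_eq_left hx))
  have hπz : π z.val = z := Subtype.ext (hπval _ z.2)
  obtain ⟨r, hr, hball⟩ : ∃ r > 0, closedBall z.val r ⊆ {x | 0 < x 0 ∧ π x ∈ φ.source} := by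
    refine nhds_basis_closedBall.mem_iff.1 (IsOpen.mem_nhds ?_ ⟨hpos, by rwa [hπz]⟩)
    exact (isOpen_lt continuous_const (EuclideanSpace.proj (𝕜 := ℝ) (0 : Fin n)).continuous).inter
      (φ.open_source.preimage hπ)
  let Ψ : ℝ → EuclideanSpace ℝ (Fin n) → EuclideanHalfSpace n := fun ε x =>
    withHeight (φ (π x)).val ((φ (π x)).val 0 + ε)
  have hΨ : ∀ ε, ∀ x, π x ∈ φ.source → ContinuousAt (Function.uncurry Ψ) (ε, x) := by
    intro ε x hx
    have h1 : ContinuousAt (fun q : ℝ × EuclideanSpace ℝ (Fin n) => (φ (π q.2)).val) (ε, x) :=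
      continuous_val.continuousAt.comp (ContinuousAt.comp (g := φ) (f := π ∘ Prod.snd)
        (φ.continuousAt hx) (hπ.comp continuous_snd).continuousAt)
    refine continuous_withHeight.continuousAt.comp (h1.prodMk ?_)
    exact ((EuclideanSpace.proj (𝕜 := ℝ) (0 : Fin n)).continuous.continuousAt.comp h1).add
      continuousAt_fst
  have hΨ0 : ∀ x, Ψ 0 x = φ (π x) := fun x =>
    withHeight_eq_self _ (by rw [add_zero, max_eq_left (φ (π x)).2])
  have hev : ∀ᶠ ε in 𝓝 (0 : ℝ), ∀ x ∈ closedBall z.val r,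
      Ψ ε x ∈ φ.target ∧ dist (φ.symm (Ψ ε x)).val x < r := by
    refine (isCompact_closedBall _ _).eventually_forall_of_forall_eventually fun x hx => ?_
    obtain ⟨hx0, hxs⟩ := hball hx
    have htgt : Function.uncurry Ψ (0, x) ∈ φ.target := by
      rw [Function.uncurry_apply_pair, hΨ0]; exact φ.map_source hxs
    refine ((hΨ 0 x hxs).eventually_mem (φ.open_target.mem_nhds htgt)).and ?_
    have h2 : ContinuousAt (fun q : ℝ × EuclideanSpace ℝ (Fin n) =>
        dist (φ.symm (Function.uncurry Ψ q)).val q.2) (0, x) :=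
      (continuous_val.continuousAt.comp
        (ContinuousAt.comp (g := φ.symm) (φ.symm.continuousAt htgt) (hΨ 0 x hxs))).dist
        continuousAt_snd
    refine h2.eventually_lt_const ?_
    simp only [Function.uncurry_apply_pair]
    rw [hΨ0, φ.left_inv hxs, hπval x hx0.le, dist_self]
    exact hr
  obtain ⟨ε, hε, hε0⟩ := ((hev.filter_mono nhdsWithin_le_nhds).and
    (self_mem_nhdsWithin (a := (0 : ℝ)) (s := Ioi 0))).exists
  obtain ⟨x, hx, hxz⟩ := exists_eq_of_dist_lt (f := fun x => (φ.symm (Ψ ε x)).val) hr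
    (fun x hx => (continuous_val.continuousAt.comp (ContinuousAt.comp (g := φ.symm)
      (φ.symm.continuousAt (hε x hx).1) ((hΨ ε x (hball hx).2).comp
        (f := fun x => (ε, x)) (by fun_prop)))).continuousWithinAt)
    (fun x hx => (hε x hx).2)
  have h3 : Ψ ε x = φ z := by
    rw [← φ.right_inv (hε x hx).1, Subtype.ext hxz]
  have h4 := congrArg (fun w => w.val 0) h3
  simp only [Ψ, withHeight_val_zero, h] at h4
  have h5 := (φ (π x)).2
  have h6 : (φ (π x)).val 0 + ε ≤ 0 := (le_max_left _ _).trans h4.le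
  have h7 : (0 : ℝ) < ε := hε0
  linarith

end EuclideanHalfSpace

section Collar

variable {F : Type*} [TopologicalSpace F]

/-- The space `F` with the half-open cylinder `B × [0, ∞)` attached along `B`. -/
abbrev ExternalCollar (B : Set F) : Type _ :=
  {z : F × ℝ // 0 ≤ z.2 ∧ (z.1 ∈ B ∨ z.2 = 0)}

/-- There is a continuous family of self-homeomorphisms of `ExternalCollar B` which push the
external collar inwards by `c * Λ`, for `c ∈ [0, 1]`. -/
def IsCollarPush (B : Set F) (Λ : F → ℝ) : Prop :=
  Continuous Λ ∧ (∀ x, 0 ≤ Λ x) ∧ ∃ f g : I → ExternalCollar B → ExternalCollar B,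
    Continuous (Function.uncurry f) ∧ Continuous (Function.uncurry g) ∧
    (∀ c z, g c (f c z) = z) ∧ (∀ c z, f c (g c z) = z) ∧
    ∀ (c : I) (z w : ExternalCollar B), z.1.1 ∈ B → w.1.1 = z.1.1 →
      w.1.2 = z.1.2 + c * Λ z.1.1 → f c w = z

theorem IsCollarPush.zero (B : Set F) : IsCollarPush B fun _ => 0 := by
  refine ⟨continuous_const, fun _ => le_rfl, fun _ z => z, fun _ z => z, continuous_snd,
    continuous_snd, fun _ _ => rfl, fun _ _ => rfl, fun c z w _ h1 h2 => ?_⟩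
  exact Subtype.ext (Prod.ext h1 (by simpa using h2))

theorem IsCollarPush.add {B : Set F} {Λ M : F → ℝ} (hΛ : IsCollarPush B Λ)
    (hM : IsCollarPush B M) : IsCollarPush B fun x => Λ x + M x := by
  obtain ⟨hΛc, hΛ0, f, g, hf, hg, hgf, hfg, hpush⟩ := hΛ
  obtain ⟨hMc, hM0, f', g', hf', hg', hgf', hfg', hpush'⟩ := hM
  refine ⟨hΛc.add hMc, fun x => add_nonneg (hΛ0 x) (hM0 x), fun c z => f' c (f c z),
    fun c z => g c (g' c z), hf'.comp (continuous_fst.prodMk hf),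
    hg.comp (continuous_fst.prodMk hg'), fun c z => by simp only [hgf', hgf],
    fun c z => by simp only [hfg, hfg'], fun c z w hz h1 h2 => ?_⟩
  have hnn : 0 ≤ z.1.2 + c * M z.1.1 := add_nonneg z.2.1 (mul_nonneg c.2.1 (hM0 _))
  have h3 : f c w = ⟨(z.1.1, z.1.2 + c * M z.1.1), hnn, Or.inl hz⟩ := by
    refine hpush c _ w hz h1 ?_
    rw [h2]
    ring
  simp only [h3]
  exact hpush' c z _ hz rfl rfl

theorem IsCollarPush.exists_sum {B : Set F} (hB : IsCompact B)
    (h : ∀ x ∈ B, ∃ Λ, IsCollarPush B Λ ∧ 0 < Λ x) :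
    ∃ Λ, IsCollarPush B Λ ∧ ∀ x ∈ B, 0 < Λ x := by
  refine hB.induction_on (p := fun s => ∃ Λ, IsCollarPush B Λ ∧ ∀ x ∈ s, 0 < Λ x)
    ⟨_, IsCollarPush.zero B, by simp⟩ ?_ ?_ ?_
  · rintro s t hst ⟨Λ, hΛ, hpos⟩
    exact ⟨Λ, hΛ, fun x hx => hpos x (hst hx)⟩
  · rintro s t ⟨Λ, hΛ, hpos⟩ ⟨M, hM, hpos'⟩
    refine ⟨_, hΛ.add hM, ?_⟩
    rintro x (hx | hx)
    · exact add_pos_of_pos_of_nonneg (hpos x hx) (hM.2.1 x)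
    · exact add_pos_of_nonneg_of_pos (hΛ.2.1 x) (hpos' x hx)
  · intro x hx
    obtain ⟨Λ, hΛ, hpos⟩ := h x hx
    exact ⟨{y | 0 < Λ y}, mem_nhdsWithin_of_mem_nhds
      ((isOpen_lt continuous_const hΛ.1).mem_nhds hpos), Λ, hΛ, fun y hy => hy⟩

variable {n : ℕ} [NeZero n]

open EuclideanHalfSpace

/-- The height to which the ball of radius `ρ` around `p` is guaranteed to contain the
vertical segment above the projection of `y` to the boundary. -/
noncomputable def collarWidth (p : EuclideanSpace ℝ (Fin n)) (ρ : ℝ)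
    (y : EuclideanSpace ℝ (Fin n)) : ℝ :=
  max 0 (ρ - dist (withHeight y 0).val p)

theorem collarWidth_nonneg (p : EuclideanSpace ℝ (Fin n)) (ρ : ℝ)
    (y : EuclideanSpace ℝ (Fin n)) : 0 ≤ collarWidth p ρ y :=
  le_max_left _ _

theorem continuous_collarWidth (p : EuclideanSpace ℝ (Fin n)) (ρ : ℝ) :
    Continuous (collarWidth p ρ) :=
  continuous_const.max (continuous_const.sub ((continuous_val.comp
    (continuous_withHeight.comp (continuous_id.prodMk continuous_const))).dist continuous_const))

@[simp]
theorem collarWidth_withHeight (p : EuclideanSpace ℝ (Fin n)) (ρ : ℝ)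
    (y : EuclideanSpace ℝ (Fin n)) (r : ℝ) :
    collarWidth p ρ (withHeight y r).val = collarWidth p ρ y := by
  simp [collarWidth]

theorem dist_withHeight_le_of_le_collarWidth {p y : EuclideanSpace ℝ (Fin n)} {ρ r : ℝ}
    (hpos : 0 < collarWidth p ρ y) (hr : r ≤ collarWidth p ρ y) :
    dist (withHeight y r).val p ≤ ρ := by
  have h1 := dist_triangle (withHeight y r).val (withHeight y 0).val p
  have h2 : max r 0 ≤ collarWidth p ρ y := max_le hr hpos.le
  rw [dist_withHeight_withHeight, max_self, sub_zero, abs_of_nonneg (le_max_right _ _)] at h1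
  have h3 : collarWidth p ρ y = ρ - dist (withHeight y 0).val p := by
    unfold collarWidth at hpos ⊢
    rcases max_cases 0 (ρ - dist (withHeight y 0).val p) with h | h
    · rw [h.1] at hpos; exact absurd hpos (lt_irrefl _)
    · exact h.1
  linarith

/-- A continuous family of reparametrizations of the line, the one with parameter `l` being
supported in `(-∞, l]`. -/
structure IsLineStretch (θ : ℝ → ℝ → ℝ) : Prop where
  continuous : Continuous (Function.uncurry θ)
  eq_self : ∀ l r, 0 ≤ l → l ≤ r → θ l r = r
  zero : ∀ r, θ 0 r = r
  le : ∀ l r, 0 ≤ l → r ≤ l → θ l r ≤ l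

/-- Push points in and out of the external collar along the vertical lines of a chart `e`. -/
noncomputable def collarStretch (e : OpenPartialHomeomorph F (EuclideanHalfSpace n))
    (p : EuclideanSpace ℝ (Fin n)) (ρ : ℝ) (θ : ℝ → ℝ → ℝ) (c : I) (z : F × ℝ) : F × ℝ :=
  open scoped Classical in
  if z.1 ∈ e.source then
    let r := θ (c * collarWidth p ρ (e z.1).val) ((e z.1).val 0 - z.2)
    (e.symm (withHeight (e z.1).val r), max 0 (-r))
  else z

section CollarStretch

variable {B : Set F} {e : OpenPartialHomeomorph F (EuclideanHalfSpace n)}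
  {p : EuclideanSpace ℝ (Fin n)} {ρ : ℝ} {θ θ' : ℝ → ℝ → ℝ} {z : F × ℝ}

theorem mul_collarWidth_nonneg (c : I) (y : EuclideanSpace ℝ (Fin n)) :
    0 ≤ c * collarWidth p ρ y :=
  mul_nonneg c.2.1 (collarWidth_nonneg p ρ y)

theorem mul_collarWidth_le (c : I) (y : EuclideanSpace ℝ (Fin n)) :
    c * collarWidth p ρ y ≤ collarWidth p ρ y :=
  mul_le_of_le_one_left (collarWidth_nonneg p ρ y) c.2.2

theorem withHeight_chart (hB : ∀ x ∈ e.source, x ∈ B ↔ (e x).val 0 = 0)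
    (hz : 0 ≤ z.2 ∧ (z.1 ∈ B ∨ z.2 = 0)) (hs : z.1 ∈ e.source) :
    withHeight (e z.1).val ((e z.1).val 0 - z.2) = e z.1 ∧
      max 0 (-((e z.1).val 0 - z.2)) = z.2 := by
  have h0 := (e z.1).2
  rcases hz.2 with h | h
  · rw [hB _ hs] at h
    exact ⟨withHeight_eq_self _ (by rw [h]; simpa using hz.1), by rw [h]; simpa using hz.1⟩
  · rw [h, sub_zero]
    exact ⟨withHeight_eq_self _ (max_eq_left h0), by simpa using h0⟩

theorem withHeight_mem_target (hρ : ∀ y : EuclideanHalfSpace n, dist y.val p ≤ ρ → y ∈ e.target)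
    (hθ : IsLineStretch θ) (hB : ∀ x ∈ e.source, x ∈ B ↔ (e x).val 0 = 0)
    (hz : 0 ≤ z.2 ∧ (z.1 ∈ B ∨ z.2 = 0)) (hs : z.1 ∈ e.source) (c : I) :
    withHeight (e z.1).val (θ (c * collarWidth p ρ (e z.1).val) ((e z.1).val 0 - z.2)) ∈
      e.target := by
  set l := c * collarWidth p ρ (e z.1).val
  have hl : 0 ≤ l := mul_collarWidth_nonneg c _
  have hl' : l ≤ collarWidth p ρ (e z.1).val := mul_collarWidth_le c _
  rcases hl.eq_or_lt with h0 | h0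
  · rw [← h0, hθ.zero, (withHeight_chart hB hz hs).1]
    exact e.map_source hs
  rcases le_or_gt l ((e z.1).val 0 - z.2) with h | h
  · rw [hθ.eq_self _ _ hl h, (withHeight_chart hB hz hs).1]
    exact e.map_source hs
  · exact hρ _ (dist_withHeight_le_of_le_collarWidth (h0.trans_le hl')
      ((hθ.le _ _ hl h.le).trans hl'))

theorem collarStretch_of_mem (hs : z.1 ∈ e.source) (c : I) :
    collarStretch e p ρ θ c z =
      (e.symm (withHeight (e z.1).val
        (θ (c * collarWidth p ρ (e z.1).val) ((e z.1).val 0 - z.2))),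
        max 0 (-θ (c * collarWidth p ρ (e z.1).val) ((e z.1).val 0 - z.2))) :=
  if_pos hs

theorem collarStretch_of_notMem (hs : z.1 ∉ e.source) (c : I) : collarStretch e p ρ θ c z = z :=
  if_neg hs

theorem collarStretch_mem (hρ : ∀ y : EuclideanHalfSpace n, dist y.val p ≤ ρ → y ∈ e.target)
    (hθ : IsLineStretch θ) (hB : ∀ x ∈ e.source, x ∈ B ↔ (e x).val 0 = 0)
    (hz : 0 ≤ z.2 ∧ (z.1 ∈ B ∨ z.2 = 0)) (c : I) :
    0 ≤ (collarStretch e p ρ θ c z).2 ∧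
      ((collarStretch e p ρ θ c z).1 ∈ B ∨ (collarStretch e p ρ θ c z).2 = 0) := by
  by_cases hs : z.1 ∈ e.source
  · have ht := withHeight_mem_target hρ hθ hB hz hs c
    rw [collarStretch_of_mem hs]
    refine ⟨le_max_left _ _, ?_⟩
    rw [hB _ (e.map_target ht), e.right_inv ht, withHeight_val_zero]
    rcases le_total 0 (θ (c * collarWidth p ρ (e z.1).val) ((e z.1).val 0 - z.2)) with h | h
    · exact Or.inr (max_eq_left (neg_nonpos.2 h))
    · exact Or.inl (max_eq_right h)
  · rwa [collarStretch_of_notMem hs]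

theorem collarStretch_collarStretch
    (hρ : ∀ y : EuclideanHalfSpace n, dist y.val p ≤ ρ → y ∈ e.target)
    (hθ : IsLineStretch θ) (hB : ∀ x ∈ e.source, x ∈ B ↔ (e x).val 0 = 0)
    (hinv : ∀ l r, 0 ≤ l → θ' l (θ l r) = r) (hz : 0 ≤ z.2 ∧ (z.1 ∈ B ∨ z.2 = 0)) (c : I) :
    collarStretch e p ρ θ' c (collarStretch e p ρ θ c z) = z := by
  by_cases hs : z.1 ∈ e.source
  · have ht := withHeight_mem_target hρ hθ hB hz hs c
    rw [collarStretch_of_mem (θ := θ) hs, collarStretch_of_mem (e.map_target ht)]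
    have hr : ∀ r : ℝ, max r 0 - max 0 (-r) = r := fun r => by
      rcases le_total 0 r with h | h <;> simp [h]
    simp only [e.right_inv ht, collarWidth_withHeight, withHeight_withHeight,
      withHeight_val_zero, hr, hinv _ _ (mul_collarWidth_nonneg c _)]
    rw [(withHeight_chart hB hz hs).1, (withHeight_chart hB hz hs).2, e.left_inv hs]
  · rw [collarStretch_of_notMem hs, collarStretch_of_notMem hs]

theorem collarStretch_eq_self (hθ : IsLineStretch θ)
    (hB : ∀ x ∈ e.source, x ∈ B ↔ (e x).val 0 = 0)
    (hz : 0 ≤ z.2 ∧ (z.1 ∈ B ∨ z.2 = 0))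
    (h : z.1 ∈ e.source → ρ < dist (e z.1).val p) (c : I) : collarStretch e p ρ θ c z = z := by
  by_cases hs : z.1 ∈ e.source
  · have hl : 0 ≤ c * collarWidth p ρ (e z.1).val := mul_collarWidth_nonneg c _
    have hl' : c * collarWidth p ρ (e z.1).val ≤ collarWidth p ρ (e z.1).val :=
      mul_collarWidth_le c _
    have hfix : θ (c * collarWidth p ρ (e z.1).val) ((e z.1).val 0 - z.2) =
        (e z.1).val 0 - z.2 := by
      rcases hl.eq_or_lt with h0 | h0
      · rw [← h0, hθ.zero]
      refine hθ.eq_self _ _ hl ?_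
      by_contra! hlt
      refine (h hs).not_ge ?_
      rw [← withHeight_eq_self (e z.1) (max_eq_left (e z.1).2)]
      refine dist_withHeight_le_of_le_collarWidth (h0.trans_le hl') ?_
      rcases hz.2 with hb | hb
      · rw [(hB _ hs).1 hb]; exact collarWidth_nonneg _ _ _
      · linarith
    rw [collarStretch_of_mem hs, hfix, (withHeight_chart hB hz hs).1,
      (withHeight_chart hB hz hs).2, e.left_inv hs]
  · exact collarStretch_of_notMem hs c

theorem isClosed_image_closedBall [T2Space F]
    (hρ : ∀ y : EuclideanHalfSpace n, dist y.val p ≤ ρ → y ∈ e.target) :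
    IsClosed (e.symm '' {y | dist y.val p ≤ ρ}) := by
  have hcl : IsClosedEmbedding (Subtype.val : EuclideanHalfSpace n → _) := by
    refine IsClosed.isClosedEmbedding_subtypeVal
      (s := {x : EuclideanSpace ℝ (Fin n) | 0 ≤ x 0}) ?_
    exact isClosed_le continuous_const (EuclideanSpace.proj (𝕜 := ℝ) (0 : Fin n)).continuous
  exact ((hcl.isCompact_preimage (isCompact_closedBall p ρ)).image_of_continuousOn
    (e.continuousOn_symm.mono hρ)).isClosed

theorem continuous_collarStretch [T2Space F]
    (hρ : ∀ y : EuclideanHalfSpace n, dist y.val p ≤ ρ → y ∈ e.target)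
    (hθ : IsLineStretch θ) (hB : ∀ x ∈ e.source, x ∈ B ↔ (e x).val 0 = 0) :
    Continuous fun q : I × ExternalCollar B => collarStretch e p ρ θ q.1 q.2.1 := by
  have hfst : Continuous fun q : I × ExternalCollar B => q.2.1.1 := by fun_prop
  refine continuous_iff_continuousAt.2 fun q => ?_
  by_cases hs : q.2.1.1 ∈ e.source
  · have hev : ∀ᶠ q' : I × ExternalCollar B in 𝓝 q, q'.2.1.1 ∈ e.source :=
      (e.open_source.preimage hfst).mem_nhds hs
    have he : ContinuousAt (fun q' : I × ExternalCollar B => (e q'.2.1.1).val) q :=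
      continuous_val.continuousAt.comp
        (ContinuousAt.comp (g := e) (e.continuousAt hs) hfst.continuousAt)
    have hr : ContinuousAt (fun q' : I × ExternalCollar B =>
        θ (q'.1 * collarWidth p ρ (e q'.2.1.1).val) ((e q'.2.1.1).val 0 - q'.2.1.2)) q := by
      refine ContinuousAt.comp (g := Function.uncurry θ) hθ.continuous.continuousAt
        (ContinuousAt.prodMk ?_ ?_)
      · exact (continuous_subtype_val.comp continuous_fst).continuousAt.mul
          ((continuous_collarWidth p ρ).continuousAt.comp he)
      · exact ((EuclideanSpace.proj (𝕜 := ℝ) (0 : Fin n)).continuous.continuousAt.comp he).sub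
          (Continuous.continuousAt (by fun_prop))
    refine ContinuousAt.congr ?_ (hev.mono fun q' hq' => (collarStretch_of_mem hq' q'.1).symm)
    have hw := ContinuousAt.comp
      (g := fun p : EuclideanSpace ℝ (Fin n) × ℝ => withHeight p.1 p.2)
      continuous_withHeight.continuousAt (he.prodMk hr)
    have hmax : Continuous fun r : ℝ => max 0 (-r) := by fun_prop
    exact ContinuousAt.prodMk
      (ContinuousAt.comp_of_eq (g := e.symm)
        (e.symm.continuousAt (withHeight_mem_target hρ hθ hB q.2.2 hs q.1)) hw rfl)
      (ContinuousAt.comp_of_eq (g := fun r : ℝ => max 0 (-r)) hmax.continuousAt hr rfl)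
  · have hev : ∀ᶠ q' : I × ExternalCollar B in 𝓝 q,
        q'.2.1.1 ∈ (e.symm '' {y | dist y.val p ≤ ρ})ᶜ := by
      refine ((isClosed_image_closedBall hρ).isOpen_compl.preimage hfst).mem_nhds ?_
      rintro ⟨y, hy, hye⟩
      have hye' : e.symm y = q.2.1.1 := hye
      exact hs (hye' ▸ e.map_target (hρ y hy))
    refine ContinuousAt.congr (f := fun q' => q'.2.1) (Continuous.continuousAt (by fun_prop))
      (hev.mono fun q' hq' => ?_)
    refine (collarStretch_eq_self hθ hB q'.2.2 (fun hs' => ?_) q'.1).symm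
    by_contra! hle
    exact hq' ⟨_, hle, e.left_inv hs'⟩

end CollarStretch

theorem isLineStretch_in : IsLineStretch fun l r => min (r + l) (max ((r + l) / 2) r) where
  continuous := by unfold Function.uncurry; fun_prop
  eq_self l r h h' := by
    rw [max_eq_right (by linarith), min_eq_right (by linarith)]
  zero r := by grind
  le l r h h' := by grind

theorem isLineStretch_out : IsLineStretch fun l r => max (r - l) (min (2 * r - l) r) where
  continuous := by unfold Function.uncurry; fun_prop
  eq_self l r h h' := by
    rw [min_eq_right (by linarith), max_eq_right (by linarith)]
  zero r := by grind
  le l r h h' := by grind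

theorem exists_isCollarPush [T2Space F] {B : Set F}
    {e : OpenPartialHomeomorph F (EuclideanHalfSpace n)}
    (hB : ∀ x ∈ e.source, x ∈ B ↔ (e x).val 0 = 0) {x : F} (hx : x ∈ e.source) :
    ∃ Λ, IsCollarPush B Λ ∧ 0 < Λ x := by
  set p := (e x).val
  obtain ⟨ρ, hρ0, hρ⟩ : ∃ ρ > 0, ∀ y : EuclideanHalfSpace n, dist y.val p ≤ ρ → y ∈ e.target := by
    have h1 : e.target ∈ 𝓝 (e x) := e.open_target.mem_nhds (e.map_source hx)
    rw [show 𝓝 (e x) = comap Subtype.val (𝓝 p) from nhds_subtype _ _,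
      (nhds_basis_closedBall.comap _).mem_iff] at h1
    obtain ⟨ρ, hρ0, h⟩ := h1
    exact ⟨ρ, hρ0, fun y hy => h hy⟩
  classical
  let Λ : F → ℝ := fun y => if y ∈ e.source then max 0 (ρ - dist (e y).val p) else 0
  have hΛ : ∀ y ∈ e.source, y ∈ B → Λ y = collarWidth p ρ (e y).val := by
    intro y hy hyB
    have h0 : withHeight (e y).val 0 = e y :=
      withHeight_eq_self _ (by rw [(hB y hy).1 hyB, max_self])
    simp only [Λ, if_pos hy, collarWidth, h0]
  have hΛc : Continuous Λ := by
    refine continuous_iff_continuousAt.2 fun y => ?_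
    by_cases hy : y ∈ e.source
    · have h1 : ContinuousAt (fun y => (e y).val) y :=
        continuous_val.continuousAt.comp (e.continuousAt hy)
      refine ContinuousAt.congr (f := fun y => max 0 (ρ - dist (e y).val p))
        (continuousAt_const.max (continuousAt_const.sub (h1.dist continuousAt_const))) ?_
      filter_upwards [e.open_source.mem_nhds hy] with w hw
      simp only [Λ, if_pos hw]
    · have hev : (e.symm '' {y | dist y.val p ≤ ρ})ᶜ ∈ 𝓝 y := by
        refine (isClosed_image_closedBall hρ).isOpen_compl.mem_nhds ?_
        rintro ⟨w, hw, hwy⟩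
        exact hy (hwy ▸ e.map_target (hρ w hw))
      refine ContinuousAt.congr (f := fun _ => 0) continuousAt_const ?_
      filter_upwards [hev] with w hw
      by_cases hw' : w ∈ e.source
      · have : ρ < dist (e w).val p := by
          by_contra! hle
          exact hw ⟨_, hle, e.left_inv hw'⟩
        simp only [Λ, if_pos hw', max_eq_left (sub_nonpos.2 this.le)]
      · simp only [Λ, if_neg hw']
  refine ⟨Λ, ⟨hΛc, fun y => ?_,
    fun c z => ⟨_, collarStretch_mem hρ isLineStretch_in hB z.2 c⟩,
    fun c z => ⟨_, collarStretch_mem hρ isLineStretch_out hB z.2 c⟩,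
    (continuous_collarStretch hρ isLineStretch_in hB).subtype_mk _,
    (continuous_collarStretch hρ isLineStretch_out hB).subtype_mk _,
    fun c z => Subtype.ext
      (collarStretch_collarStretch (θ' := fun l r => max (r - l) (min (2 * r - l) r)) hρ
        isLineStretch_in hB (fun l r h => ?_) z.2 c),
    fun c z => Subtype.ext
      (collarStretch_collarStretch (θ' := fun l r => min (r + l) (max ((r + l) / 2) r)) hρ
        isLineStretch_out hB (fun l r h => ?_) z.2 c),
    fun c z w hz h1 h2 => Subtype.ext ?_⟩, ?_⟩
  · simp only [Λ]
    split_ifs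
    exacts [le_max_left _ _, le_rfl]
  · grind
  · grind
  · by_cases hs : z.1.1 ∈ e.source
    · have hz0 := (hB _ hs).1 hz
      have hz2 := z.2.1
      have hl : 0 ≤ c * collarWidth p ρ (e z.1.1).val := mul_collarWidth_nonneg c _
      have hs' : w.1.1 ∈ e.source := by rwa [h1]
      rw [hΛ _ hs hz] at h2
      simp only
      rw [collarStretch_of_mem hs', h1, h2, hz0]
      have h3 : min (0 - (z.1.2 + c * collarWidth p ρ (e z.1.1).val) +
          c * collarWidth p ρ (e z.1.1).val)
          (max ((0 - (z.1.2 + c * collarWidth p ρ (e z.1.1).val) +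
          c * collarWidth p ρ (e z.1.1).val) / 2)
          (0 - (z.1.2 + c * collarWidth p ρ (e z.1.1).val))) = -z.1.2 := by
        grind
      rw [h3, withHeight_eq_self _ (by rw [hz0]; simpa using hz2), e.left_inv hs, neg_neg,
        max_eq_right hz2]
    · have hs' : w.1.1 ∉ e.source := by rwa [h1]
      simp only [Λ, if_neg hs, mul_zero, add_zero] at h2
      simp only
      rw [collarStretch_of_notMem hs']
      exact Prod.ext h1 h2
  · simp only [Λ, if_pos hx, p, dist_self, sub_zero]
    exact lt_max_of_lt_right hρ0

end Collar

theorem exists_mul_eq_of_le_two_mul {u v : ℝ} (hu : 0 ≤ u) (huv : u ≤ 2 * (1 - v ^ 2)) :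
    ∃ a τ : ℝ, 0 ≤ a ∧ a ≤ 1 ∧ |τ| ≤ 1 ∧ (1 - a ^ 2) * (1 + τ ^ 2) = u ∧ a * τ = v := by
  obtain ⟨w, hw⟩ := IsAlgClosed.exists_pow_nat_eq (⟨1 - v ^ 2 - u, 2 * v⟩ : ℂ) two_pos
  have hre : w.re * w.re - w.im * w.im = 1 - v ^ 2 - u := by
    simpa [sq, Complex.mul_re] using congrArg Complex.re hw
  have him : w.re * w.im = v := by
    have : w.re * w.im + w.im * w.re = 2 * v := by
      simpa [sq, Complex.mul_im] using congrArg Complex.im hw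
    linarith
  have h1 : (1 - w.re ^ 2) * (1 + w.im ^ 2) = u := by rw [← him] at hre; linarith
  have h2 : 0 ≤ (1 + w.re ^ 2) * (1 - w.im ^ 2) := by rw [← him] at hre huv; linarith
  have h3 : |w.re| ≤ 1 := by
    rw [← sq_le_one_iff_abs_le_one]
    by_contra! h
    nlinarith [sq_nonneg w.im]
  have h4 : |w.im| ≤ 1 := by
    rw [← sq_le_one_iff_abs_le_one]
    by_contra! h
    nlinarith [sq_nonneg w.re]
  rcases le_total 0 w.re with h | h
  · exact ⟨w.re, w.im, h, (abs_le.1 h3).2, h4, h1, him⟩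
  · exact ⟨-w.re, -w.im, by linarith, by linarith [(abs_le.1 h3).1], by rwa [abs_neg],
      by linarith [h1], by linarith [him]⟩

theorem eq_or_eq_neg_of_mul_eq_mul {a a' τ τ' : ℝ} (ha : 0 ≤ a) (ha' : 0 ≤ a')
    (hu : (1 - a ^ 2) * (1 + τ ^ 2) = (1 - a' ^ 2) * (1 + τ' ^ 2)) (hv : a * τ = a' * τ') :
    a = a' ∧ (τ' = τ ∨ a = 0 ∧ τ' = -τ) := by
  have hv2 : (a * τ) ^ 2 = (a' * τ') ^ 2 := by rw [hv]
  have h : (⟨a, τ⟩ : ℂ) ^ 2 = ⟨a', τ'⟩ ^ 2 := by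
    apply Complex.ext
    · simp only [sq, Complex.mul_re]; linarith
    · simp only [sq, Complex.mul_im]; linarith
  rcases sq_eq_sq_iff_eq_or_eq_neg.1 h with h | h
  · have h1 := congrArg Complex.re h
    have h2 := congrArg Complex.im h
    exact ⟨h1, Or.inl h2.symm⟩
  · have h1 : a = -a' := by simpa using congrArg Complex.re h
    have h2 : τ = -τ' := by simpa using congrArg Complex.im h
    exact ⟨by linarith, Or.inr ⟨by linarith, by linarith⟩⟩

theorem mul_le_two_mul_one_sub_sq {a τ : ℝ} (hτ : |τ| ≤ 1) :
    (1 - a ^ 2) * (1 + τ ^ 2) ≤ 2 * (1 - (a * τ) ^ 2) := by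
  have : τ ^ 2 ≤ 1 := (sq_le_one_iff_abs_le_one τ).2 hτ
  nlinarith [mul_nonneg (add_nonneg zero_le_one (sq_nonneg a)) (sub_nonneg.2 this)]

section Fold

variable {F : Type*} [TopologicalSpace F]

theorem IsCollarPush.exists_pos {B : Set F} {Λ : F → ℝ} (hB : IsCompact B)
    (h : IsCollarPush B Λ) (hpos : ∀ x ∈ B, 0 < Λ x) :
    ∃ Λ, IsCollarPush B Λ ∧ ∀ x, 0 < Λ x := by
  obtain ⟨δ, hδ, hle⟩ : ∃ δ > 0, ∀ x ∈ B, δ ≤ Λ x := by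
    rcases B.eq_empty_or_nonempty with rfl | hne
    · exact ⟨1, one_pos, by simp⟩
    · obtain ⟨x, hx, hmin⟩ := hB.exists_isMinOn hne h.1.continuousOn
      exact ⟨Λ x, hpos x hx, fun y hy => hmin hy⟩
  obtain ⟨hc, h0, f, g, hf, hg, hgf, hfg, hpush⟩ := h
  refine ⟨fun x => max (Λ x) δ, ⟨hc.max continuous_const, fun x => le_max_of_le_left (h0 x),
    f, g, hf, hg, hgf, hfg, fun c z w hz h1 h2 => hpush c z w hz h1 ?_⟩,
    fun x => lt_max_of_lt_right hδ⟩
  rw [h2]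
  simp only [max_eq_left (hle _ hz)]

theorem nonempty_homeomorph_quot_fold [CompactSpace F] [T2Space F] {B : Set F}
    {Φ : F × I → F × I}
    (hc : Continuous Φ) (hs : Function.Surjective Φ)
    (hB : ∀ x ∈ B, ∀ t, Φ (x, t) = Φ (x, σ t))
    (hi : ∀ x t y s, Φ (x, t) = Φ (y, s) → x = y ∧ (s = t ∨ x ∈ B ∧ s = σ t)) :
    Nonempty (Quot (fun p q : F × I => ∃ x ∈ B, ∃ t : I, p = (x, t) ∧ q = (x, σ t)) ≃ₜ
      F × I) := by
  let Ψ : Quot (fun p q : F × I => ∃ x ∈ B, ∃ t : I, p = (x, t) ∧ q = (x, σ t)) → F × I :=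
    Quot.lift Φ (by rintro _ _ ⟨x, hx, t, rfl, rfl⟩; exact hB x hx t)
  have hΨ : Continuous Ψ := continuous_quot_lift _ hc
  have hbij : Function.Bijective Ψ := by
    refine ⟨?_, fun y => ?_⟩
    · rintro ⟨x, t⟩ ⟨y, s⟩ h
      obtain ⟨rfl, rfl | ⟨hx, rfl⟩⟩ := hi x t y s h
      · rfl
      · exact Quot.sound ⟨x, hx, t, rfl, rfl⟩
    · obtain ⟨x, hx⟩ := hs y
      exact ⟨Quot.mk _ x, hx⟩
  exact ⟨Continuous.homeoOfEquivCompactToT2 (f := Equiv.ofBijective Ψ hbij) hΨ⟩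

/-- The fold in a collar. The homeomorphism is induced by the map which, in collar coordinates
`(a, τ) ∈ [0, 1] × [-1, 1]` near `B × [0, 1]`, is the complex squaring map `a + τ i ↦ (a + τ i) ^ 2`,
up to a change of coordinates identifying its image with the same rectangle. -/
theorem IsCollarPush.nonempty_homeomorph_quot_fold [CompactSpace F] [T2Space F] {B : Set F}
    {Λ : F → ℝ} (h : IsCollarPush B Λ) (hpos : ∀ x, 0 < Λ x) :
    Nonempty (Quot (fun p q : F × I => ∃ x ∈ B, ∃ t : I, p = (x, t) ∧ q = (x, σ t)) ≃ₜ
      F × I) := by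
  obtain ⟨hΛ, -, f, g, hf, hg, hgf, hfg, hpush⟩ := h
  have hfin : ∀ c, Function.Injective (f c) := fun c => Function.LeftInverse.injective (hgf c)
  have hf0 : ∀ (c : I) (z : ExternalCollar B), (f c z).1.2 = 0 ↔ z.1.2 ≤ c * Λ z.1.1 := by
    intro c z
    refine ⟨fun h0 => ?_, fun hle => ?_⟩
    · by_contra! hlt
      have hnn : 0 ≤ c * Λ z.1.1 := mul_nonneg c.2.1 (hpos _).le
      have hzB : z.1.1 ∈ B := z.2.2.resolve_right (hnn.trans_lt hlt).ne'
      rw [hpush c ⟨(z.1.1, z.1.2 - c * Λ z.1.1), sub_nonneg.2 hlt.le, Or.inl hzB⟩ z hzB rfl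
        (by ring)] at h0
      exact (sub_pos.2 hlt).ne' h0
    · by_contra hne
      have hB := (f c z).2.2.resolve_right hne
      have h0 : 0 < (f c z).1.2 := lt_of_le_of_ne (f c z).2.1 (Ne.symm hne)
      have hw := hfin c (hpush c (f c z) ⟨((f c z).1.1, (f c z).1.2 + c * Λ (f c z).1.1),
        add_nonneg h0.le (mul_nonneg c.2.1 (hpos _).le), Or.inl hB⟩ hB rfl rfl)
      rw [← hw] at hle
      simp only at hle
      linarith
  let ι : F → ExternalCollar B := fun x => ⟨(x, 0), le_rfl, Or.inr rfl⟩
  have hι : ∀ {c : I} {z : ExternalCollar B}, z.1.2 ≤ c * Λ z.1.1 →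
      f c z = ι (f c z).1.1 := fun h => Subtype.ext (Prod.ext rfl ((hf0 _ _).2 h))
  have hgι : ∀ c x, (g c (ι x)).1.2 ≤ c * Λ (g c (ι x)).1.1 := fun c x => by
    rw [← hf0, hfg]
  have hιc : Continuous ι := by fun_prop
  let Z : F → ExternalCollar B := fun x => g 1 (ι x)
  have hZc : Continuous Z := hg.comp (continuous_const.prodMk hιc)
  have hZi : Function.Injective Z := fun x y hxy => by
    have := Function.LeftInverse.injective (hfg 1) hxy
    exact congrArg (fun z => z.1.1) this
  have hZle : ∀ x, (Z x).1.2 ≤ Λ (Z x).1.1 := fun x => by simpa using hgι 1 x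
  have hZf : ∀ z : ExternalCollar B, z.1.2 ≤ Λ z.1.1 → Z (f 1 z).1.1 = z := fun z hz => by
    simp only [Z]
    rw [← hι (by simpa using hz), hgf]
  let a : ExternalCollar B → ℝ := fun z => 1 - z.1.2 / Λ z.1.1
  have hac : Continuous a := by
    refine continuous_const.sub (Continuous.div (by fun_prop) (by fun_prop) fun z => (hpos _).ne')
  have ha1 : ∀ z, a z ≤ 1 := fun z => sub_le_self _ (div_nonneg z.2.1 (hpos _).le)
  have ha0 : ∀ z, z.1.2 ≤ Λ z.1.1 → 0 ≤ a z := fun z hz =>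
    sub_nonneg.2 (div_le_one_of_le₀ hz (hpos _).le)
  have haB : ∀ z, a z = 1 ∨ z.1.1 ∈ B := fun z => by
    rcases z.2.2 with h | h
    · exact Or.inr h
    · exact Or.inl (by simp [a, h])
  have haz : ∀ z, z.1.2 = (1 - a z) * Λ z.1.1 := fun z => by
    simp only [a]
    field_simp [(hpos z.1.1).ne']
    ring
  let τ : I → ℝ := fun t => 1 - 2 * t
  have hτ : ∀ t, |τ t| ≤ 1 := fun t => abs_le.2 ⟨by simp only [τ]; linarith [t.2.2],
    by simp only [τ]; linarith [t.2.1]⟩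
  let v : F × I → ℝ := fun p => a (Z p.1) * τ p.2
  have hv : ∀ p, |v p| ≤ 1 := fun p => by
    simp only [v]
    rw [abs_mul, abs_of_nonneg (ha0 _ (hZle _))]
    exact mul_le_one₀ (ha1 _) (abs_nonneg _) (hτ _)
  let u : F × I → ℝ := fun p => (1 - a (Z p.1) ^ 2) * (1 + τ p.2 ^ 2)
  have hu0 : ∀ p, 0 ≤ u p := fun p => mul_nonneg
    (sub_nonneg.2 (pow_le_one₀ (ha0 _ (hZle _)) (ha1 _))) (by positivity)
  let c : F × I → I := fun p => ⟨1 - v p ^ 2, sub_nonneg.2 ((sq_le_one_iff_abs_le_one _).2 (hv p)),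
    sub_le_self _ (sq_nonneg _)⟩
  let W : F × I → ExternalCollar B := fun p => ⟨((Z p.1).1.1, Λ (Z p.1).1.1 / 2 * u p),
    mul_nonneg (half_pos (hpos _)).le (hu0 p), (haB (Z p.1)).symm.imp_right fun h => by simp [u, h]⟩
  have hWle : ∀ p, (W p).1.2 ≤ c p * Λ (W p).1.1 := fun p => by
    have h1 : u p ≤ 2 * (1 - v p ^ 2) := mul_le_two_mul_one_sub_sq (hτ p.2)
    have h2 := hpos (Z p.1).1.1
    simp only [W, c]
    nlinarith
  let h : F × I → I := fun p => ⟨(1 - v p) / 2, by linarith [(abs_le.1 (hv p)).2],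
    by linarith [(abs_le.1 (hv p)).1]⟩
  have hτc : Continuous τ := by fun_prop
  have hvc : Continuous v :=
    (hac.comp (hZc.comp continuous_fst)).mul (hτc.comp continuous_snd)
  have huc : Continuous u :=
    (continuous_const.sub ((hac.comp (hZc.comp continuous_fst)).pow 2)).mul
      (continuous_const.add ((hτc.comp continuous_snd).pow 2))
  have hcc : Continuous c := (continuous_const.sub (hvc.pow 2)).subtype_mk _
  have hhc : Continuous h := ((continuous_const.sub hvc).div_const 2).subtype_mk _
  have hZ1 : Continuous fun p : F × I => (Z p.1).1.1 :=
    continuous_fst.comp (continuous_subtype_val.comp (hZc.comp continuous_fst))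
  have hWc : Continuous W :=
    (hZ1.prodMk (((hΛ.comp hZ1).div_const 2).mul huc)).subtype_mk _
  refine _root_.nonempty_homeomorph_quot_fold (Φ := fun p => ((f (c p) (W p)).1.1, h p))
    ((continuous_fst.comp (continuous_subtype_val.comp
      (hf.comp (hcc.prodMk hWc)))).prodMk hhc) ?_ ?_ ?_
  · rintro ⟨y, w⟩
    set V : ℝ := 1 - 2 * w
    have hV : |V| ≤ 1 := hτ w
    let C : I := ⟨1 - V ^ 2, sub_nonneg.2 ((sq_le_one_iff_abs_le_one _).2 hV),
      sub_le_self _ (sq_nonneg _)⟩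
    set q := g C (ι y) with hq
    have hq2 : q.1.2 ≤ (1 - V ^ 2) * Λ q.1.1 := hgι C y
    obtain ⟨α, T, hα0, hα1, hT, hαT, hVT, hqB⟩ : ∃ α T : ℝ, 0 ≤ α ∧ α ≤ 1 ∧ |T| ≤ 1 ∧
        Λ q.1.1 / 2 * ((1 - α ^ 2) * (1 + T ^ 2)) = q.1.2 ∧ α * T = V ∧ (q.1.1 ∈ B ∨ α = 1) := by
      rcases q.2.2 with hqB | hq0
      · have hΛq := hpos q.1.1
        obtain ⟨α, T, h1, h2, h3, h4, h5⟩ := exists_mul_eq_of_le_two_mul (u := 2 * q.1.2 / Λ q.1.1)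
          (v := V) (div_nonneg (mul_nonneg two_pos.le q.2.1) hΛq.le)
          ((div_le_iff₀ hΛq).2 (by linarith))
        refine ⟨α, T, h1, h2, h3, ?_, h5, Or.inl hqB⟩
        rw [h4]
        field_simp
      · exact ⟨1, V, zero_le_one, le_rfl, hV, by simp [hq0], one_mul _, Or.inr rfl⟩
    let z : ExternalCollar B := ⟨(q.1.1, (1 - α) * Λ q.1.1),
      mul_nonneg (sub_nonneg.2 hα1) (hpos _).le, hqB.imp_right fun h => by simp [h]⟩
    have hz : z.1.2 ≤ Λ z.1.1 := by
      have := mul_nonneg hα0 (hpos q.1.1).le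
      simp only [z]
      linarith
    have haz' : a z = α := by
      have := (hpos q.1.1).ne'
      simp only [a, z]
      field_simp
      ring
    let t : I := ⟨(1 - T) / 2, by linarith [(abs_le.1 hT).2], by linarith [(abs_le.1 hT).1]⟩
    have ht : τ t = T := by simp only [τ, t]; ring
    have hZz := hZf z hz
    have hvp : v ((f 1 z).1.1, t) = V := by simp only [v, hZz, ht, haz', hVT]
    have hcp : c ((f 1 z).1.1, t) = C := Subtype.ext (by simp only [c, hvp, C])
    have hWp : W ((f 1 z).1.1, t) = q := by
      refine Subtype.ext (Prod.ext ?_ ?_)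
      · simp only [W, hZz, z]
      · simp only [W, u, hZz, haz', ht]
        exact hαT
    refine ⟨((f 1 z).1.1, t), Prod.ext ?_ (Subtype.ext ?_)⟩
    · simp only [hcp, hWp, hq, hfg, ι]
    · simp only [h, hvp, V]
      ring
  · intro x hx t
    have h1 : f 1 ⟨(x, Λ x), (hpos x).le, Or.inl hx⟩ = ι x := by
      refine hpush 1 _ _ hx rfl ?_
      simp [ι]
    have h2 : a (Z x) = 0 := by
      simp only [Z]
      rw [← h1, hgf]
      simp [a, (hpos x).ne']
    have h3 : τ (σ t) = -τ t := by simp only [τ, coe_symm_eq]; ring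
    have h4 : v (x, σ t) = v (x, t) := by simp only [v, h2, zero_mul]
    have h5 : u (x, σ t) = u (x, t) := by simp only [u, h3, neg_sq]
    have h6 : c (x, σ t) = c (x, t) := Subtype.ext (by simp only [c, h4])
    have h7 : W (x, σ t) = W (x, t) := Subtype.ext (by simp only [W, h5])
    have h8 : h (x, σ t) = h (x, t) := Subtype.ext (by simp only [h, h4])
    simp only [h6, h7, h8]
  · intro x t y s hxy
    obtain ⟨h1, h2⟩ := Prod.ext_iff.1 hxy
    have h3 : v (x, t) = v (y, s) := by
      have := congrArg Subtype.val h2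
      simp only [h] at this
      linarith
    have h4 : c (x, t) = c (y, s) := Subtype.ext (by simp only [c, h3])
    have h5 : W (x, t) = W (y, s) := by
      refine hfin (c (y, s)) ?_
      rw [hι (hWle (y, s)), ← h4, hι (hWle (x, t))]
      simp only at h1
      rw [h1, h4]
    have h6 : (Z x).1.1 = (Z y).1.1 := congrArg (fun z => z.1.1) h5
    have h7 : u (x, t) = u (y, s) := by
      have : Λ (Z x).1.1 / 2 * u (x, t) = Λ (Z y).1.1 / 2 * u (y, s) :=
        congrArg (fun z => z.1.2) h5
      rw [h6] at this
      exact mul_left_cancel₀ (half_pos (hpos _)).ne' this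
    obtain ⟨h8, h9⟩ := eq_or_eq_neg_of_mul_eq_mul (ha0 _ (hZle x)) (ha0 _ (hZle y)) h7 h3
    have hxy : x = y := hZi (Subtype.ext (Prod.ext h6 (by rw [haz, haz (Z y), h8, h6])))
    refine ⟨hxy, h9.imp (fun h9 => Subtype.ext ?_) fun h9 => ⟨?_, Subtype.ext ?_⟩⟩
    · simp only [τ] at h9
      linarith
    · have hzB : (Z x).1.1 ∈ B := (haB _).resolve_left (by rw [h9.1]; exact zero_ne_one)
      have hz : f 1 (Z x) = ι (Z x).1.1 := hpush 1 _ _ hzB rfl (by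
        have := haz (Z x)
        rw [h9.1] at this
        simpa [ι] using this)
      have hx : (Z x).1.1 = x := by
        have := congrArg (fun z => z.1.1) hz
        simp only [Z, hfg] at this
        exact this.symm
      rwa [hx] at hzB
    · have h10 := h9.2
      simp only [τ] at h10
      rw [coe_symm_eq]
      linarith

end Fold

section ManifoldBoundary

theorem mem_manifoldBoundary_iff {n : ℕ} [NeZero n] {F : Type*} [TopologicalSpace F]
    [ChartedSpace (EuclideanHalfSpace n) F] {e : OpenPartialHomeomorph F (EuclideanHalfSpace n)}
    (he : e ∈ atlas (EuclideanHalfSpace n) F) {x : F} (hx : x ∈ e.source) :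
    x ∈ manifoldBoundary n F ↔ (e x).val 0 = 0 := by
  refine ⟨?_, fun h => ⟨e, he, hx, h⟩⟩
  rintro ⟨e', -, hx', h⟩
  refine EuclideanHalfSpace.val_zero_eq_zero_of_openPartialHomeomorph (e.symm.trans e')
    (z := e x) ?_ ?_
  · simp [hx, hx', e.map_source hx]
  · simpa [e.left_inv hx] using h

theorem isClosed_manifoldBoundary (n : ℕ) [NeZero n] (F : Type*) [TopologicalSpace F]
    [ChartedSpace (EuclideanHalfSpace n) F] : IsClosed (manifoldBoundary n F) := by
  refine isOpen_compl_iff.1 (isOpen_iff_mem_nhds.2 fun x hx => ?_)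
  set e := chartAt (EuclideanHalfSpace n) x
  have hxs : x ∈ e.source := mem_chart_source _ x
  have he : e ∈ atlas (EuclideanHalfSpace n) F := chart_mem_atlas _ x
  have h0 : (e x).val 0 ≠ 0 := fun h => hx ((mem_manifoldBoundary_iff he hxs).2 h)
  have hc : ContinuousAt (fun y => (e y).val 0) x :=
    ((EuclideanSpace.proj (𝕜 := ℝ) (0 : Fin n)).continuous.comp
      continuous_subtype_val).continuousAt.comp (e.continuousAt hxs)
  filter_upwards [hc.eventually_ne h0, e.open_source.mem_nhds hxs] with y hy hys hyB
  exact hy ((mem_manifoldBoundary_iff he hys).1 hyB)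

end ManifoldBoundary

end

/-- The "fold" lemma: if `F` is a compact topological `n`-manifold with boundary and `∼` is
the equivalence relation on `F × [0,1]` generated by `(x,t) ∼ (x, 1-t)` for `x ∈ ∂F`,
then the quotient `(F × [0,1])/∼` is homeomorphic to `F × [0,1]`. -/
theorem fold_quotient_homeomorph (n : ℕ) [NeZero n] (F : Type*) [TopologicalSpace F]
    [T2Space F] [CompactSpace F] [ChartedSpace (EuclideanHalfSpace n) F] :
    Nonempty
      (Quot (fun p q : F × I =>
          ∃ x ∈ manifoldBoundary n F, ∃ t : I, p = (x, t) ∧ q = (x, σ t))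
        ≃ₜ F × I) := by
  have hB := (isClosed_manifoldBoundary n F).isCompact
  obtain ⟨Λ, hΛ, hpos⟩ := IsCollarPush.exists_sum hB fun x _ => exists_isCollarPush
    (fun y hy => mem_manifoldBoundary_iff (chart_mem_atlas (EuclideanHalfSpace n) x) hy)
    (mem_chart_source _ x)
  obtain ⟨M, hM, hMpos⟩ := hΛ.exists_pos hB hpos
  exact hM.nonempty_homeomorph_quot_fold hMpos
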